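/- arXiv:2305.14248 — 2 statements merged into one kernel-verified Lean document; each statement's English description precedes it below -/
import Mathlib

section
/- Let Z be a standard Gaussian random vector in R^d, p ≥ 2, k ∈ N, and M ∈ (R^d)^{⊗(k+1)} a deterministic tensor. Then E[‖M H_k(Z)‖^p]^{2/p} ≤ (p−1)^k · k! · ‖M‖², where M H_k(Z) ∈ R^d is the contraction (M H_k(Z))_i = Σ_{j ∈ {1,...,d}^k} M_{i,j} (H_k(Z))_j and ‖M‖ is the Hilbert–Schmidt norm. -/
open MeasureTheory ProbabilityTheory

/-- The standard Gaussian measure on `ℝ^d`. -/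
noncomputable def stdGaussian (d : ℕ) : Measure (EuclideanSpace ℝ (Fin d)) :=
  Measure.map (⇑(EuclideanSpace.equiv (Fin d) ℝ).symm)
    (Measure.pi fun _ : Fin d => gaussianReal 0 1)

/-- The `j`-th component, `j ∈ {1,…,d}^k`, of the `k`-th multivariate Hermite polynomial
tensor `H_k(x) = e^{‖x‖²/2} ∇^k e^{−‖x‖²/2}`. -/
noncomputable def hermiteTensor (d k : ℕ) (x : EuclideanSpace ℝ (Fin d))
    (j : Fin k → Fin d) : ℝ :=
  Real.exp (‖x‖ ^ 2 / 2) *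
    iteratedFDeriv ℝ k (fun y : EuclideanSpace ℝ (Fin d) => Real.exp (-‖y‖ ^ 2 / 2)) x
      (fun l => EuclideanSpace.single (j l) 1)

open Finset

/-! ### Hermite polynomials as multivariate polynomials -/

/-- The operator `P ↦ ∂ᵢ P - xᵢ P`. -/
noncomputable def hermiteRaise {d : ℕ} (i : Fin d) (P : MvPolynomial (Fin d) ℝ) :
    MvPolynomial (Fin d) ℝ :=
  MvPolynomial.pderiv i P - MvPolynomial.X i * P

/-- The polynomial whose evaluation is the component `j` of the Hermite tensor of order `k`. -/
noncomputable def hermitePoly (d : ℕ) : (k : ℕ) → (Fin k → Fin d) → MvPolynomial (Fin d) ℝ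
  | 0, _ => 1
  | k + 1, j => hermiteRaise (j 0) (hermitePoly d k (Fin.tail j))

/-- The contraction of the Hermite tensor of order `k` with the tensor `m`. -/
noncomputable def hermiteSum (d k : ℕ) (m : (Fin k → Fin d) → ℝ) : MvPolynomial (Fin d) ℝ :=
  ∑ j, MvPolynomial.C (m j) * hermitePoly d k j

lemma pderiv_pderiv_comm {σ : Type*} (i j : σ) (P : MvPolynomial σ ℝ) :
    MvPolynomial.pderiv i (MvPolynomial.pderiv j P) =
      MvPolynomial.pderiv j (MvPolynomial.pderiv i P) := by
  classical
  have h : ⁅(MvPolynomial.pderiv i : Derivation ℝ (MvPolynomial σ ℝ) (MvPolynomial σ ℝ)),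
      (MvPolynomial.pderiv j : Derivation ℝ (MvPolynomial σ ℝ) (MvPolynomial σ ℝ))⁆ = 0 := by
    refine MvPolynomial.derivation_ext fun l => ?_
    rw [Derivation.commutator_apply]
    by_cases h₁ : l = i <;> by_cases h₂ : l = j <;>
      simp [MvPolynomial.pderiv_X, Pi.single_apply, h₁, h₂, apply_ite]
  have := DFunLike.congr_fun h P
  rw [Derivation.commutator_apply] at this
  exact sub_eq_zero.mp this

lemma pderiv_hermiteRaise {d : ℕ} (i l : Fin d) (P : MvPolynomial (Fin d) ℝ) :
    MvPolynomial.pderiv i (hermiteRaise l P) =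
      hermiteRaise l (MvPolynomial.pderiv i P) - if l = i then P else 0 := by
  simp only [hermiteRaise, map_sub, pderiv_pderiv_comm i l, MvPolynomial.pderiv_mul,
    MvPolynomial.pderiv_X, Pi.single_apply]
  split_ifs <;> simp_all
  ring

lemma hermiteRaise_sum {d : ℕ} {ι : Type*} (s : Finset ι) (i : Fin d)
    (P : ι → MvPolynomial (Fin d) ℝ) :
    hermiteRaise i (∑ a ∈ s, P a) = ∑ a ∈ s, hermiteRaise i (P a) := by
  simp [hermiteRaise, mul_sum]

lemma hermiteRaise_C_mul {d : ℕ} (i : Fin d) (c : ℝ) (P : MvPolynomial (Fin d) ℝ) :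
    hermiteRaise i (MvPolynomial.C c * P) = MvPolynomial.C c * hermiteRaise i P := by
  simp only [hermiteRaise, MvPolynomial.pderiv_C_mul]
  ring

lemma pderiv_hermitePoly {d : ℕ} (i : Fin d) (k : ℕ) (j : Fin (k + 1) → Fin d) :
    MvPolynomial.pderiv i (hermitePoly d (k + 1) j) =
      -∑ l, if j l = i then hermitePoly d k (j ∘ l.succAbove) else 0 := by
  induction k with
  | zero =>
    rw [hermitePoly, pderiv_hermiteRaise]
    rw [Fin.sum_univ_succ]
    simp only [hermitePoly, hermiteRaise]
    simp
  | succ k ih =>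
    rw [hermitePoly, pderiv_hermiteRaise, ih, Fin.sum_univ_succ (n := k + 1)]
    have h : ∀ l : Fin (k + 1), hermitePoly d (k + 1) (j ∘ l.succ.succAbove) =
        hermiteRaise (j 0) (hermitePoly d k (Fin.tail j ∘ l.succAbove)) := by
      intro l
      have htail : Fin.tail (j ∘ l.succ.succAbove) = Fin.tail j ∘ l.succAbove := by
        funext x
        simp [Fin.tail]
      rw [hermitePoly, htail]
      simp
    have h0 : hermitePoly d (k + 1) (j ∘ (0 : Fin (k + 2)).succAbove) =
        hermitePoly d (k + 1) (Fin.tail j) := by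
      congr 1
    simp only [h, h0]
    have h1 : ∀ Q : MvPolynomial (Fin d) ℝ, hermiteRaise (j 0) (-Q) = -hermiteRaise (j 0) Q := by
      intro Q
      simp [hermiteRaise]; ring
    rw [h1, hermiteRaise_sum]
    have h2 : ∀ l : Fin (k + 1), hermiteRaise (j 0)
        (if Fin.tail j l = i then hermitePoly d k (Fin.tail j ∘ l.succAbove) else 0) =
        if j l.succ = i then
          hermiteRaise (j 0) (hermitePoly d k (Fin.tail j ∘ l.succAbove)) else 0 := by
      intro l
      rw [Fin.tail, apply_ite (hermiteRaise (j 0))]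
      simp [hermiteRaise]
    simp only [h2]
    ring

lemma sum_insertNth {d k : ℕ} {A : Type*} [AddCommMonoid A] (l : Fin (k + 1))
    (f : (Fin (k + 1) → Fin d) → A) :
    ∑ j, f j = ∑ i, ∑ j : Fin k → Fin d, f (l.insertNth i j) := by
  rw [← Fintype.sum_prod_type', ← (Fin.insertNthEquiv (fun _ => Fin d) l).sum_comp]
  rfl

lemma hermiteSum_succ {d k : ℕ} (m : (Fin (k + 1) → Fin d) → ℝ) :
    hermiteSum d (k + 1) m =
      ∑ i, hermiteRaise i
        (hermiteSum d k fun j => m ((0 : Fin (k + 1)).insertNth (α := fun _ => Fin d) i j)) := by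
  rw [hermiteSum, sum_insertNth 0]
  simp only [hermiteSum, hermiteRaise_sum, hermiteRaise_C_mul]
  simp [hermitePoly]

lemma pderiv_hermiteSum {d k : ℕ} (i : Fin d) (m : (Fin (k + 1) → Fin d) → ℝ) :
    MvPolynomial.pderiv i (hermiteSum d (k + 1) m) =
      -∑ l : Fin (k + 1),
        hermiteSum d k fun j => m (l.insertNth (α := fun _ => Fin d) i j) := by
  simp only [hermiteSum, map_sum, MvPolynomial.pderiv_C_mul, pderiv_hermitePoly, mul_neg,
    sum_neg_distrib, mul_sum]
  rw [sum_comm]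
  congr 1
  refine sum_congr rfl fun l _ => ?_
  rw [sum_insertNth l, sum_comm]
  refine sum_congr rfl fun j _ => ?_
  have h : (l.insertNth (α := fun _ => Fin d) i j) ∘ l.succAbove = j := by
    ext x; simp
  rw [sum_eq_single i]
  · simp [h]
  · intro b _ hb
    simp [hb]
  · simp

/-! ### Derivatives of polynomial functions -/

lemma hasFDerivAt_eval {d : ℕ} (P : MvPolynomial (Fin d) ℝ) (x : EuclideanSpace ℝ (Fin d)) :
    HasFDerivAt (fun y : EuclideanSpace ℝ (Fin d) => MvPolynomial.eval y P)
      (∑ i, MvPolynomial.eval x (MvPolynomial.pderiv i P) •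
        (EuclideanSpace.proj i : EuclideanSpace ℝ (Fin d) →L[ℝ] ℝ)) x := by
  induction P using MvPolynomial.induction_on with
  | C a => simpa using hasFDerivAt_const a x
  | add P Q hP hQ =>
    simp only [map_add, add_smul, sum_add_distrib]
    exact hP.add hQ
  | mul_X P l hP =>
    have hl : HasFDerivAt (fun y : EuclideanSpace ℝ (Fin d) => y l)
        (EuclideanSpace.proj l : EuclideanSpace ℝ (Fin d) →L[ℝ] ℝ) x :=
      (EuclideanSpace.proj l : EuclideanSpace ℝ (Fin d) →L[ℝ] ℝ).hasFDerivAt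
    simp only [map_mul, MvPolynomial.eval_X]
    refine (hP.mul hl).congr_fderiv ?_
    ext v
    simp [MvPolynomial.pderiv_X, Pi.single_apply, apply_ite, add_mul,
      sum_add_distrib, mul_sum]
    exact sum_congr rfl fun i _ => by ring

lemma hasFDerivAt_eval_mul_exp {d : ℕ} (P : MvPolynomial (Fin d) ℝ)
    (x : EuclideanSpace ℝ (Fin d)) :
    HasFDerivAt (fun y : EuclideanSpace ℝ (Fin d) =>
        Real.exp (-‖y‖ ^ 2 / 2) * MvPolynomial.eval y P)
      (∑ i, (Real.exp (-‖x‖ ^ 2 / 2) * MvPolynomial.eval x (hermiteRaise i P)) •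
        (EuclideanSpace.proj i : EuclideanSpace ℝ (Fin d) →L[ℝ] ℝ)) x := by
  have h₁ : HasFDerivAt (fun y : EuclideanSpace ℝ (Fin d) => Real.exp (-‖y‖ ^ 2 / 2))
      (Real.exp (-‖x‖ ^ 2 / 2) • (-innerSL ℝ x)) x := by
    refine HasFDerivAt.exp ?_
    refine (((hasStrictFDerivAt_norm_sq x).hasFDerivAt.neg).mul_const (2⁻¹ : ℝ)).congr_fderiv ?_
    ext v
    simp
  refine (h₁.mul (hasFDerivAt_eval P x)).congr_fderiv ?_
  ext v
  simp [hermiteRaise, PiLp.inner_apply, mul_sum, sub_mul, mul_sub, - sum_neg_distrib]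
  rw [← sub_eq_add_neg, ← sum_sub_distrib, ← sum_sub_distrib]
  exact sum_congr rfl fun i _ => by ring

lemma iteratedFDeriv_exp_neg_norm_sq (d k : ℕ) (x : EuclideanSpace ℝ (Fin d))
    (j : Fin k → Fin d) :
    iteratedFDeriv ℝ k (fun y : EuclideanSpace ℝ (Fin d) => Real.exp (-‖y‖ ^ 2 / 2)) x
        (fun l => EuclideanSpace.single (j l) 1) =
      Real.exp (-‖x‖ ^ 2 / 2) * MvPolynomial.eval x (hermitePoly d k j) := by
  induction k generalizing x with
  | zero => simp [hermitePoly]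
  | succ k ih =>
    have hc : ContDiff ℝ (k + 1 : ℕ)
        (fun y : EuclideanSpace ℝ (Fin d) => Real.exp (-‖y‖ ^ 2 / 2)) :=
      (((contDiff_norm_sq ℝ).neg).div_const 2).exp
    rw [((hc.differentiable_iteratedFDeriv (m := k)
      (by exact_mod_cast Nat.lt_succ_self k)) x).iteratedFDeriv_succ_apply_left']
    have : (fun y => iteratedFDeriv ℝ k
        (fun y : EuclideanSpace ℝ (Fin d) => Real.exp (-‖y‖ ^ 2 / 2)) y
        (Fin.tail fun l => EuclideanSpace.single (j l) 1)) =
        fun y : EuclideanSpace ℝ (Fin d) =>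
          Real.exp (-‖y‖ ^ 2 / 2) * MvPolynomial.eval y (hermitePoly d k (Fin.tail j)) :=
      funext fun y => ih y (Fin.tail j)
    rw [this, (hasFDerivAt_eval_mul_exp _ x).fderiv]
    simp [hermitePoly]

lemma hermiteTensor_eq_eval (d k : ℕ) (x : EuclideanSpace ℝ (Fin d)) (j : Fin k → Fin d) :
    hermiteTensor d k x j = MvPolynomial.eval x (hermitePoly d k j) := by
  rw [hermiteTensor, iteratedFDeriv_exp_neg_norm_sq, ← mul_assoc, ← Real.exp_add]
  ring_nf
  simp

/-! ### The standard Gaussian measure -/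

lemma stdGaussian_eq (d : ℕ) :
    _root_.stdGaussian d = ProbabilityTheory.stdGaussian (EuclideanSpace ℝ (Fin d)) :=
  map_pi_eq_stdGaussian

instance isGaussian_euclidean_stdGaussian (d : ℕ) : IsGaussian (_root_.stdGaussian d) := by
  rw [stdGaussian_eq]
  infer_instance

/-- Up to a constant, `exp (-‖x‖² / 2)` is the density of the standard Gaussian measure. -/
lemma exists_stdGaussian_eq_withDensity (d : ℕ) : ∃ c : ℝ, 0 < c ∧
    _root_.stdGaussian d = (volume : Measure (EuclideanSpace ℝ (Fin d))).withDensity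
      (fun x => ENNReal.ofReal (c * Real.exp (-‖x‖ ^ 2 / 2))) := by
  have hdens : ∀ x : Fin d → ℝ, ∏ i, gaussianPDFReal 0 1 (x i) =
      (√(2 * Real.pi))⁻¹ ^ d * Real.exp (-‖WithLp.toLp 2 x‖ ^ 2 / 2) := by
    intro x
    simp only [gaussianPDFReal, prod_mul_distrib, ← Real.exp_sum, EuclideanSpace.real_norm_sq_eq]
    simp [sum_div, neg_div]
  have hpi : Measure.pi (fun _ : Fin d => gaussianReal 0 1) =
      (volume : Measure (Fin d → ℝ)).withDensity
        (fun x => ENNReal.ofReal (∏ i, gaussianPDFReal 0 1 (x i))) := by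
    refine Measure.pi_eq fun s hs => ?_
    rw [withDensity_apply _ (MeasurableSet.univ_pi hs), volume_pi, Measure.restrict_pi_pi,
      ← ofReal_integral_eq_lintegral_ofReal
        (Integrable.fintype_prod fun i => (integrable_gaussianPDFReal 0 1).restrict)
        (ae_of_all _ fun x => prod_nonneg fun i _ => gaussianPDFReal_nonneg 0 1 _),
      integral_fintype_prod_eq_prod (fun _ => gaussianPDFReal 0 1),
      ENNReal.ofReal_prod_of_nonneg
        fun i _ => integral_nonneg fun x => gaussianPDFReal_nonneg 0 1 _]
    refine prod_congr rfl fun i _ => ?_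
    rw [gaussianReal_apply_eq_integral 0 one_ne_zero]
  refine ⟨(√(2 * Real.pi))⁻¹ ^ d, by positivity, ?_⟩
  have hmap : _root_.stdGaussian d =
      (Measure.pi fun _ : Fin d => gaussianReal 0 1).map (MeasurableEquiv.toLp 2 (Fin d → ℝ)) :=
    rfl
  rw [hmap, hpi]
  ext s hs
  rw [MeasurableEquiv.map_apply, withDensity_apply _ hs,
    withDensity_apply _ ((MeasurableEquiv.toLp 2 (Fin d → ℝ)).measurable hs),
    ← (PiLp.volume_preserving_toLp (Fin d)).setLIntegral_comp_preimage hs (by fun_prop)]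
  simp only [hdens]
  rfl

/-- The functions of at most polynomial growth. -/
def PolyGrowth {E : Type*} [NormedAddCommGroup E] (f : E → ℝ) : Prop :=
  ∃ (C : ℝ) (N : ℕ), 0 ≤ C ∧ ∀ x, |f x| ≤ C * (1 + ‖x‖) ^ N

namespace PolyGrowth

variable {E : Type*} [NormedAddCommGroup E] {f g : E → ℝ}

lemma mul (hf : PolyGrowth f) (hg : PolyGrowth g) : PolyGrowth fun x => f x * g x := by
  obtain ⟨C, N, hC, h⟩ := hf
  obtain ⟨D, K, hD, h'⟩ := hg
  refine ⟨C * D, N + K, by positivity, fun x => ?_⟩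
  rw [abs_mul]
  calc |f x| * |g x| ≤ (C * (1 + ‖x‖) ^ N) * (D * (1 + ‖x‖) ^ K) :=
        mul_le_mul (h x) (h' x) (abs_nonneg _) (by positivity)
    _ = _ := by ring

lemma add (hf : PolyGrowth f) (hg : PolyGrowth g) : PolyGrowth fun x => f x + g x := by
  obtain ⟨C, N, hC, h⟩ := hf
  obtain ⟨D, K, hD, h'⟩ := hg
  refine ⟨C + D, N + K, by positivity, fun x => ?_⟩
  have h1 : (1 : ℝ) ≤ 1 + ‖x‖ := by linarith [norm_nonneg x]
  have hN : (1 + ‖x‖) ^ N ≤ (1 + ‖x‖) ^ (N + K) := pow_le_pow_right₀ h1 (by omega)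
  have hK : (1 + ‖x‖) ^ K ≤ (1 + ‖x‖) ^ (N + K) := pow_le_pow_right₀ h1 (by omega)
  calc |f x + g x| ≤ |f x| + |g x| := abs_add_le _ _
    _ ≤ C * (1 + ‖x‖) ^ N + D * (1 + ‖x‖) ^ K := add_le_add (h x) (h' x)
    _ ≤ C * (1 + ‖x‖) ^ (N + K) + D * (1 + ‖x‖) ^ (N + K) := by gcongr
    _ = _ := by ring

lemma abs_rpow (hf : PolyGrowth f) {q : ℝ} (hq : 0 ≤ q) : PolyGrowth fun x => |f x| ^ q := by
  obtain ⟨C, N, hC, h⟩ := hf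
  obtain ⟨K, hK⟩ := exists_nat_ge (N * q)
  refine ⟨C ^ q, K, by positivity, fun x => ?_⟩
  have h1 : (1 : ℝ) ≤ 1 + ‖x‖ := by linarith [norm_nonneg x]
  rw [abs_of_nonneg (by positivity)]
  calc |f x| ^ q ≤ (C * (1 + ‖x‖) ^ N) ^ q := Real.rpow_le_rpow (abs_nonneg _) (h x) hq
    _ = C ^ q * (1 + ‖x‖) ^ (N * q) := by
      rw [Real.mul_rpow hC (by positivity), ← Real.rpow_natCast, ← Real.rpow_mul (by positivity)]
    _ ≤ C ^ q * (1 + ‖x‖) ^ K := by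
      rw [← Real.rpow_natCast _ K]
      gcongr

lemma integrable [MeasurableSpace E] [BorelSpace E] [NormedSpace ℝ E] [CompleteSpace E]
    [SecondCountableTopology E] {μ : Measure E} [IsGaussian μ]
    (hf : PolyGrowth f) (hc : Continuous f) : Integrable f μ := by
  obtain ⟨C, N, hC, h⟩ := hf
  have hmem : MemLp (fun x : E => 1 + ‖x‖) (N : ENNReal) μ :=
    (memLp_const (1 : ℝ)).add (IsGaussian.memLp_id μ (N : ENNReal) (ENNReal.natCast_ne_top N)).norm
  have hint : Integrable (fun x : E => C * (1 + ‖x‖) ^ N) μ := by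
    refine Integrable.const_mul ?_ C
    refine hmem.integrable_norm_pow'.congr (ae_of_all _ fun x => ?_)
    simp only
    rw [Real.norm_of_nonneg (by positivity)]
  exact hint.mono' hc.aestronglyMeasurable (ae_of_all _ h)

lemma memLp [MeasurableSpace E] [BorelSpace E] [NormedSpace ℝ E] [CompleteSpace E]
    [SecondCountableTopology E] {μ : Measure E} [IsGaussian μ]
    (hf : PolyGrowth f) (hc : Continuous f) {q : ℝ} (hq : 0 < q) :
    MemLp f (ENNReal.ofReal q) μ := by
  rw [← integrable_norm_rpow_iff hc.aestronglyMeasurable (by simpa using hq) (by simp),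
    ENNReal.toReal_ofReal hq.le]
  exact (hf.abs_rpow hq.le).integrable
    (hc.abs.rpow_const fun _ => Or.inr hq.le)

end PolyGrowth

lemma polyGrowth_eval {d : ℕ} (P : MvPolynomial (Fin d) ℝ) :
    PolyGrowth fun x : EuclideanSpace ℝ (Fin d) => MvPolynomial.eval x P := by
  induction P using MvPolynomial.induction_on with
  | C a => exact ⟨|a|, 0, abs_nonneg a, fun x => by simp⟩
  | add P Q hP hQ => simpa using hP.add hQ
  | mul_X P l hP =>
    have hl : PolyGrowth fun x : EuclideanSpace ℝ (Fin d) => x l :=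
      ⟨1, 1, zero_le_one, fun x => by
        have := PiLp.norm_apply_le x l
        rw [Real.norm_eq_abs] at this
        linarith⟩
    simpa using hP.mul hl

lemma continuous_eval {d : ℕ} (P : MvPolynomial (Fin d) ℝ) :
    Continuous fun x : EuclideanSpace ℝ (Fin d) => MvPolynomial.eval x P :=
  continuous_iff_continuousAt.mpr fun x => (hasFDerivAt_eval P x).continuousAt

/-- **Gaussian integration by parts** against `∂ᵢ P - xᵢ P`. -/
lemma integral_hermiteRaise_mul {d : ℕ} (i : Fin d) (P : MvPolynomial (Fin d) ℝ)
    {g g' : EuclideanSpace ℝ (Fin d) → ℝ} (hg : Continuous g) (hg' : Continuous g')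
    (hpg : PolyGrowth g) (hpg' : PolyGrowth g')
    (hd : ∀ x, HasLineDerivAt ℝ g (g' x) x (EuclideanSpace.single i 1)) :
    ∫ x, MvPolynomial.eval x (hermiteRaise i P) * g x ∂_root_.stdGaussian d =
      -∫ x, MvPolynomial.eval x P * g' x ∂_root_.stdGaussian d := by
  obtain ⟨c, hc, hγ⟩ := exists_stdGaussian_eq_withDensity d
  have hm : Measurable fun x : EuclideanSpace ℝ (Fin d) => c * Real.exp (-‖x‖ ^ 2 / 2) := by
    fun_prop
  have hint : ∀ f : EuclideanSpace ℝ (Fin d) → ℝ, ∫ x, f x ∂_root_.stdGaussian d =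
      c * ∫ x, Real.exp (-‖x‖ ^ 2 / 2) * f x := by
    intro f
    rw [hγ, integral_withDensity_eq_integral_toReal_smul hm.ennreal_ofReal
      (ae_of_all _ fun x => ENNReal.ofReal_lt_top), ← integral_const_mul]
    refine integral_congr_ae (ae_of_all _ fun x => ?_)
    simp only
    rw [ENNReal.toReal_ofReal (by positivity), smul_eq_mul, mul_assoc]
  have hinteg : ∀ f : EuclideanSpace ℝ (Fin d) → ℝ, Continuous f → PolyGrowth f →
      Integrable fun x => Real.exp (-‖x‖ ^ 2 / 2) * f x := by
    intro f hf hpf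
    have h := hpf.integrable (μ := _root_.stdGaussian d) hf
    rw [hγ, integrable_withDensity_iff_integrable_smul' hm.ennreal_ofReal
      (ae_of_all _ fun x => ENNReal.ofReal_lt_top)] at h
    refine (h.const_mul c⁻¹).congr (ae_of_all _ fun x => ?_)
    simp only
    rw [ENNReal.toReal_ofReal (by positivity), smul_eq_mul]
    field_simp
  have key := integral_bilinear_hasLineDerivAt_right_eq_neg_left_of_integrable
    (μ := (volume : Measure (EuclideanSpace ℝ (Fin d)))) (B := ContinuousLinearMap.mul ℝ ℝ)
    (f := fun x : EuclideanSpace ℝ (Fin d) => Real.exp (-‖x‖ ^ 2 / 2) * MvPolynomial.eval x P)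
    (f' := fun x : EuclideanSpace ℝ (Fin d) =>
      Real.exp (-‖x‖ ^ 2 / 2) * MvPolynomial.eval x (hermiteRaise i P))
    (g := g) (g' := g') (v := EuclideanSpace.single i 1)
    (by simpa [mul_assoc] using
      hinteg _ ((continuous_eval _).mul hg) ((polyGrowth_eval _).mul hpg))
    (by simpa [mul_assoc] using
      hinteg _ ((continuous_eval _).mul hg') ((polyGrowth_eval _).mul hpg'))
    (by simpa [mul_assoc] using
      hinteg _ ((continuous_eval _).mul hg) ((polyGrowth_eval _).mul hpg))
    (fun x _ => by
      have := (hasFDerivAt_eval_mul_exp P x).hasLineDerivAt (EuclideanSpace.single i 1)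
      simpa [Pi.single_apply] using this)
    (fun x _ => hd x)
  simp only [ContinuousLinearMap.mul_apply', mul_assoc] at key
  rw [hint, hint, key]
  ring

/-! ### Moment bounds -/

lemma hasDerivAt_abs_rpow_mul_self {q : ℝ} (hq : 0 ≤ q) (t : ℝ) :
    HasDerivAt (fun s : ℝ => |s| ^ q * s) ((q + 1) * |t| ^ q) t := by
  rcases hq.eq_or_lt with rfl | hq
  · simpa using hasDerivAt_id' t
  · rcases eq_or_ne t 0 with rfl | ht
    · have hc : Filter.Tendsto (fun s : ℝ => |s| ^ q) (nhdsWithin 0 {0}ᶜ) (nhds 0) := by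
        have : ContinuousAt (fun s : ℝ => |s| ^ q) 0 :=
          continuous_abs.continuousAt.rpow_const (Or.inr hq.le)
        simpa [ContinuousAt, Real.zero_rpow hq.ne'] using this.tendsto.mono_left nhdsWithin_le_nhds
      rw [hasDerivAt_iff_tendsto_slope]
      simp only [abs_zero, Real.zero_rpow hq.ne', mul_zero]
      refine hc.congr' ?_
      filter_upwards [self_mem_nhdsWithin] with s hs
      have hs : s ≠ 0 := hs
      simp [slope_def_field, hs]
    · have h₁ := ((hasDerivAt_abs ht).rpow_const (p := q) (Or.inl (abs_ne_zero.mpr ht))).mul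
        (hasDerivAt_id t)
      refine h₁.congr_deriv ?_
      have h₂ : |t| ^ q = |t| ^ (q - 1) * |t| := by
        rw [Real.rpow_sub_one (abs_ne_zero.mpr ht)]
        field_simp
      have h₃ : ((SignType.sign t : SignType) : ℝ) * t = |t| := sign_mul_self t
      simp only [id, mul_one]
      rw [h₂, ← h₃]
      ring

lemma abs_rpow_sub_two_mul_sq {p : ℝ} (hp : 2 ≤ p) (t : ℝ) : |t| ^ (p - 2) * t ^ 2 = |t| ^ p := by
  rcases eq_or_ne t 0 with rfl | ht
  · simp [Real.zero_rpow (by linarith : p ≠ 0)]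
  · rw [← sq_abs t, ← Real.rpow_natCast |t| 2, ← Real.rpow_add (abs_pos.mpr ht)]
    norm_num

lemma rpow_two_div_le_of_le_mul {I S p : ℝ} (hp : 2 ≤ p) (hI : 0 ≤ I) (hS : 0 ≤ S)
    (h : I ≤ I ^ ((p - 2) / p) * S) : I ^ (2 / p) ≤ S := by
  have hp0 : 0 < p := by linarith
  rcases hI.eq_or_lt with rfl | hI
  · rwa [Real.zero_rpow (by positivity)]
  · have h₁ : I = I ^ ((p - 2) / p) * I ^ (2 / p) := by
      rw [← Real.rpow_add hI, ← add_div, sub_add_cancel, div_self hp0.ne', Real.rpow_one]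
    exact le_of_mul_le_mul_left (h₁.symm.trans_le h) (Real.rpow_pos_of_pos hI _)

lemma integral_abs_rpow_sub_two_mul_sq_le {E : Type*} [NormedAddCommGroup E] [NormedSpace ℝ E]
    [MeasurableSpace E] [BorelSpace E] [CompleteSpace E] [SecondCountableTopology E]
    {μ : Measure E} [IsGaussian μ] {p : ℝ} (hp : 2 ≤ p) {f g : E → ℝ} (hf : Continuous f)
    (hg : Continuous g) (hpf : PolyGrowth f) (hpg : PolyGrowth g) :
    ∫ x, |f x| ^ (p - 2) * g x ^ 2 ∂μ ≤
      (∫ x, |f x| ^ p ∂μ) ^ ((p - 2) / p) * (∫ x, |g x| ^ p ∂μ) ^ (2 / p) := by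
  rcases hp.eq_or_lt with rfl | hp
  · simp
  have h2 : 0 < p - 2 := by linarith
  have hconj : (p / (p - 2)).HolderConjugate (p / 2) := by
    rw [Real.holderConjugate_iff]
    refine ⟨(one_lt_div h2).mpr (by linarith), ?_⟩
    field_simp
    ring
  have h := integral_mul_le_Lp_mul_Lq_of_nonneg (μ := μ) hconj
    (f := fun x => |f x| ^ (p - 2)) (g := fun x => |g x| ^ (2 : ℝ))
    (ae_of_all _ fun x => by positivity) (ae_of_all _ fun x => by positivity)
    ((hpf.abs_rpow h2.le).memLp (hf.abs.rpow_const fun _ => Or.inr h2.le) (by positivity))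
    ((hpg.abs_rpow zero_le_two).memLp (hg.abs.rpow_const fun _ => Or.inr zero_le_two)
      (by positivity))
  have e₁ : ∀ x, (|f x| ^ (p - 2)) ^ (p / (p - 2)) = |f x| ^ p := fun x => by
    rw [← Real.rpow_mul (abs_nonneg _), mul_div_cancel₀ _ h2.ne']
  have e₂ : ∀ x, (|g x| ^ (2 : ℝ)) ^ (p / 2) = |g x| ^ p := fun x => by
    rw [← Real.rpow_mul (abs_nonneg _), mul_div_cancel₀ _ two_ne_zero]
  simp only [e₁, e₂, one_div_div] at h
  simpa using h

lemma integral_abs_eval_hermiteSum_rpow {d k : ℕ} {p : ℝ} (hp : 2 ≤ p)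
    (m : (Fin (k + 1) → Fin d) → ℝ) :
    ∫ x, |MvPolynomial.eval x.ofLp (hermiteSum d (k + 1) m)| ^ p ∂_root_.stdGaussian d =
      ∑ i, ∑ l : Fin (k + 1), (p - 1) *
        ∫ x, |MvPolynomial.eval x.ofLp (hermiteSum d (k + 1) m)| ^ (p - 2) *
          (MvPolynomial.eval x.ofLp (hermiteSum d k fun j =>
              m ((0 : Fin (k + 1)).insertNth (α := fun _ => Fin d) i j)) *
            MvPolynomial.eval x.ofLp (hermiteSum d k fun j =>
              m (l.insertNth (α := fun _ => Fin d) i j))) ∂_root_.stdGaussian d := by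
  set P := hermiteSum d (k + 1) m with hP
  set G : Fin (k + 1) → Fin d → MvPolynomial (Fin d) ℝ := fun l i =>
    hermiteSum d k fun j => m (l.insertNth (α := fun _ => Fin d) i j) with hG
  have hPsum : P = ∑ i, hermiteRaise i (G 0 i) := hermiteSum_succ m
  have hdP : ∀ i, MvPolynomial.pderiv i P = -∑ l, G l i := fun i => pderiv_hermiteSum i m
  have hp2 : 0 ≤ p - 2 := by linarith
  have hcont : Continuous fun x : EuclideanSpace ℝ (Fin d) =>
      |MvPolynomial.eval x.ofLp P| ^ (p - 2) :=
    (continuous_eval P).abs.rpow_const fun _ => Or.inr hp2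
  have hgrow : PolyGrowth fun x : EuclideanSpace ℝ (Fin d) =>
      |MvPolynomial.eval x.ofLp P| ^ (p - 2) := (polyGrowth_eval P).abs_rpow hp2
  have hcont_mul : ∀ Q : MvPolynomial (Fin d) ℝ, Continuous fun x : EuclideanSpace ℝ (Fin d) =>
      |MvPolynomial.eval x.ofLp P| ^ (p - 2) * MvPolynomial.eval x.ofLp Q :=
    fun Q => hcont.mul (continuous_eval Q)
  have hφg := hgrow.mul (polyGrowth_eval P)
  have hparts : ∀ i, ∫ x, MvPolynomial.eval x.ofLp (hermiteRaise i (G 0 i)) *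
        (|MvPolynomial.eval x.ofLp P| ^ (p - 2) * MvPolynomial.eval x.ofLp P)
          ∂_root_.stdGaussian d =
      ∑ l, (p - 1) * ∫ x, |MvPolynomial.eval x.ofLp P| ^ (p - 2) *
        (MvPolynomial.eval x.ofLp (G 0 i) * MvPolynomial.eval x.ofLp (G l i))
          ∂_root_.stdGaussian d := by
    intro i
    have hφ' : ∀ x : EuclideanSpace ℝ (Fin d), HasLineDerivAt ℝ
        (fun y : EuclideanSpace ℝ (Fin d) =>
          |MvPolynomial.eval y.ofLp P| ^ (p - 2) * MvPolynomial.eval y.ofLp P)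
        (|MvPolynomial.eval x.ofLp P| ^ (p - 2) *
          MvPolynomial.eval x.ofLp (MvPolynomial.C (p - 1) * MvPolynomial.pderiv i P)) x
        (EuclideanSpace.single i 1) := by
      intro x
      have h := ((hasDerivAt_abs_rpow_mul_self hp2 (MvPolynomial.eval x.ofLp P)).comp_hasFDerivAt x
        (hasFDerivAt_eval P x)).hasLineDerivAt (EuclideanSpace.single i 1)
      refine (congrArg (HasLineDerivAt ℝ _ · x _) ?_).mp h
      simp
      ring
    rw [integral_hermiteRaise_mul i (G 0 i) (hcont_mul _) (hcont_mul _) hφg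
      (hgrow.mul (polyGrowth_eval _)) hφ', ← integral_neg]
    simp_rw [← integral_const_mul]
    rw [← integral_finsetSum]
    · refine integral_congr_ae (ae_of_all _ fun x => ?_)
      simp only [hdP, map_mul, map_neg, map_sum, MvPolynomial.eval_C, mul_sum, mul_neg,
        ← sum_neg_distrib]
      exact sum_congr rfl fun l _ => by ring
    · intro l _
      exact ((hgrow.mul ((polyGrowth_eval _).mul (polyGrowth_eval _))).integrable
        (hcont.mul ((continuous_eval _).mul (continuous_eval _)))).const_mul _
  rw [← sum_congr rfl fun i _ => hparts i, ← integral_finsetSum]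
  · refine integral_congr_ae (ae_of_all _ fun x => ?_)
    simp only
    rw [← sum_mul, ← map_sum, ← hPsum, ← abs_rpow_sub_two_mul_sq hp]
    ring
  · intro i _
    exact ((polyGrowth_eval _).mul hφg).integrable ((continuous_eval _).mul (hcont_mul P))

/-- Hypercontractive moment bound for a scalar element of the `k`-th Wiener chaos. -/
lemma integral_abs_eval_hermiteSum_rpow_le {d : ℕ} {p : ℝ} (hp : 2 ≤ p) (k : ℕ)
    (m : (Fin k → Fin d) → ℝ) :
    (∫ x, |MvPolynomial.eval x.ofLp (hermiteSum d k m)| ^ p ∂_root_.stdGaussian d) ^ (2 / p) ≤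
      (p - 1) ^ k * k.factorial * ∑ j, m j ^ 2 := by
  have hp0 : 0 < p := by linarith
  have hp1 : 0 ≤ p - 1 := by linarith
  have hp2 : 0 ≤ p - 2 := by linarith
  induction k with
  | zero =>
    simp only [hermiteSum, hermitePoly, mul_one, univ_unique, sum_singleton, MvPolynomial.eval_C,
      integral_const, probReal_univ, one_smul, pow_zero, Nat.factorial_zero, Nat.cast_one, one_mul]
    rw [← Real.rpow_mul (abs_nonneg _), mul_div_cancel₀ _ hp0.ne', Real.rpow_two, sq_abs]
  | succ k ih =>
    set P := hermiteSum d (k + 1) m with hP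
    set G : Fin (k + 1) → Fin d → MvPolynomial (Fin d) ℝ := fun l i =>
      hermiteSum d k fun j => m (l.insertNth (α := fun _ => Fin d) i j) with hG
    set I := ∫ x, |MvPolynomial.eval x.ofLp P| ^ p ∂_root_.stdGaussian d with hI
    set N : Fin (k + 1) → Fin d → ℝ := fun l i =>
      (∫ x, |MvPolynomial.eval x.ofLp (G l i)| ^ p ∂_root_.stdGaussian d) ^ (2 / p) with hN
    have hI0 : 0 ≤ I := integral_nonneg fun x => by positivity
    have hN0 : ∀ l i, 0 ≤ N l i := fun l i =>
      Real.rpow_nonneg (integral_nonneg fun x => by positivity) _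
    have hcont : Continuous fun x : EuclideanSpace ℝ (Fin d) =>
        |MvPolynomial.eval x.ofLp P| ^ (p - 2) :=
      (continuous_eval P).abs.rpow_const fun _ => Or.inr hp2
    have hgrow : PolyGrowth fun x : EuclideanSpace ℝ (Fin d) =>
        |MvPolynomial.eval x.ofLp P| ^ (p - 2) := (polyGrowth_eval P).abs_rpow hp2
    have hint : ∀ Q R : MvPolynomial (Fin d) ℝ, Integrable (fun x : EuclideanSpace ℝ (Fin d) =>
        |MvPolynomial.eval x.ofLp P| ^ (p - 2) *
          (MvPolynomial.eval x.ofLp Q * MvPolynomial.eval x.ofLp R)) (_root_.stdGaussian d) :=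
      fun Q R => (hgrow.mul ((polyGrowth_eval _).mul (polyGrowth_eval _))).integrable
        (hcont.mul ((continuous_eval _).mul (continuous_eval _)))
    have hholder : ∀ l i, ∫ x, |MvPolynomial.eval x.ofLp P| ^ (p - 2) *
        (MvPolynomial.eval x.ofLp (G l i) * MvPolynomial.eval x.ofLp (G l i))
          ∂_root_.stdGaussian d ≤ I ^ ((p - 2) / p) * N l i := by
      intro l i
      simp only [← sq]
      exact integral_abs_rpow_sub_two_mul_sq_le hp (continuous_eval _) (continuous_eval _)
        (polyGrowth_eval _) (polyGrowth_eval _)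
    have hcross : ∀ l i, ∫ x, |MvPolynomial.eval x.ofLp P| ^ (p - 2) *
        (MvPolynomial.eval x.ofLp (G 0 i) * MvPolynomial.eval x.ofLp (G l i))
          ∂_root_.stdGaussian d ≤ I ^ ((p - 2) / p) * ((N 0 i + N l i) / 2) := by
      intro l i
      have h : ∫ x, |MvPolynomial.eval x.ofLp P| ^ (p - 2) *
          (MvPolynomial.eval x.ofLp (G 0 i) * MvPolynomial.eval x.ofLp (G l i))
            ∂_root_.stdGaussian d ≤
          ∫ x, (|MvPolynomial.eval x.ofLp P| ^ (p - 2) *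
              (MvPolynomial.eval x.ofLp (G 0 i) * MvPolynomial.eval x.ofLp (G 0 i)) +
            |MvPolynomial.eval x.ofLp P| ^ (p - 2) *
              (MvPolynomial.eval x.ofLp (G l i) * MvPolynomial.eval x.ofLp (G l i))) / 2
            ∂_root_.stdGaussian d := by
        refine integral_mono (hint _ _) (((hint _ _).add (hint _ _)).div_const 2) fun x => ?_
        have hw : 0 ≤ |MvPolynomial.eval x.ofLp P| ^ (p - 2) := by positivity
        simp only
        nlinarith [mul_nonneg hw (sq_nonneg
          (MvPolynomial.eval x.ofLp (G 0 i) - MvPolynomial.eval x.ofLp (G l i)))]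
      rw [integral_div, integral_add (hint _ _) (hint _ _)] at h
      linarith [hholder 0 i, hholder l i]
    have hbound : I ^ (2 / p) ≤ ∑ i, ∑ l, (p - 1) * ((N 0 i + N l i) / 2) := by
      refine rpow_two_div_le_of_le_mul hp hI0 (sum_nonneg fun i _ => sum_nonneg fun l _ =>
        mul_nonneg hp1 (by linarith [hN0 0 i, hN0 l i])) ?_
      calc I = ∑ i, ∑ l, (p - 1) * ∫ x, |MvPolynomial.eval x.ofLp P| ^ (p - 2) *
            (MvPolynomial.eval x.ofLp (G 0 i) * MvPolynomial.eval x.ofLp (G l i))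
              ∂_root_.stdGaussian d := integral_abs_eval_hermiteSum_rpow hp m
        _ ≤ ∑ i, ∑ l, (p - 1) * (I ^ ((p - 2) / p) * ((N 0 i + N l i) / 2)) := by
          gcongr with i _ l _
          exact hcross l i
        _ = _ := by
          simp only [mul_sum]
          exact sum_congr rfl fun i _ => sum_congr rfl fun l _ => by ring
    have hNle : ∀ l, ∑ i, N l i ≤ (p - 1) ^ k * k.factorial * ∑ j, m j ^ 2 := by
      intro l
      rw [sum_insertNth l, mul_sum]
      exact sum_le_sum fun i _ => ih _
    calc I ^ (2 / p) ≤ ∑ i, ∑ l, (p - 1) * ((N 0 i + N l i) / 2) := hbound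
      _ = ∑ l : Fin (k + 1), (p - 1) / 2 * (∑ i, N 0 i + ∑ i, N l i) := by
        rw [sum_comm]
        refine sum_congr rfl fun l _ => ?_
        rw [← sum_add_distrib, mul_sum]
        exact sum_congr rfl fun i _ => by ring
      _ ≤ ∑ l : Fin (k + 1), (p - 1) / 2 * ((p - 1) ^ k * k.factorial * ∑ j, m j ^ 2 +
            (p - 1) ^ k * k.factorial * ∑ j, m j ^ 2) := by
        gcongr with l _
        · exact hNle 0
        · exact hNle l
      _ = _ := by
        rw [sum_const, card_univ, Fintype.card_fin, Nat.factorial_succ, nsmul_eq_mul]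
        push_cast
        ring

/-- For `Z` standard Gaussian in `ℝ^d`, `p ≥ 2`, `k ∈ ℕ` and a deterministic tensor
`M ∈ (ℝ^d)^{⊗(k+1)}`, the contraction `M H_k(Z)` satisfies
`E[‖M H_k(Z)‖^p]^{2/p} ≤ (p−1)^k k! ‖M‖²` where `‖M‖` is the Hilbert–Schmidt norm. -/
theorem hermite_contraction_moment_bound {Ω : Type*} [MeasurableSpace Ω] (μ : Measure Ω)
    [IsProbabilityMeasure μ] (d : ℕ) (Z : Ω → EuclideanSpace ℝ (Fin d))
    (hZ : Measurable Z) (hZd : Measure.map Z μ = stdGaussian d)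
    (p : ℝ) (hp : 2 ≤ p) (k : ℕ) (M : Fin d → (Fin k → Fin d) → ℝ) :
    (∫ ω, (Real.sqrt (∑ i : Fin d,
        (∑ j : Fin k → Fin d, M i j * hermiteTensor d k (Z ω) j) ^ 2)) ^ p ∂μ) ^ (2 / p) ≤
      (p - 1) ^ k * (Nat.factorial k) *
        (∑ i : Fin d, ∑ j : Fin k → Fin d, (M i j) ^ 2) := by
  have hp0 : 0 < p := by linarith
  have hp2 : 0 ≤ p - 2 := by linarith
  set F : Fin d → MvPolynomial (Fin d) ℝ := fun i => hermiteSum d k (M i) with hF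
  set A : EuclideanSpace ℝ (Fin d) → ℝ :=
    fun x => |MvPolynomial.eval x.ofLp (∑ i, F i ^ 2)| ^ (1 / 2 : ℝ) with hA
  have hA0 : ∀ x, 0 ≤ A x := fun x => by positivity
  have hAc : Continuous A := (continuous_eval _).abs.rpow_const fun _ => Or.inr (by norm_num)
  have hAg : PolyGrowth A := (polyGrowth_eval _).abs_rpow (by norm_num)
  have hsum : ∀ x : EuclideanSpace ℝ (Fin d), 0 ≤ ∑ i, MvPolynomial.eval x.ofLp (F i) ^ 2 :=
    fun x => sum_nonneg fun i _ => sq_nonneg _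
  have hAsq : ∀ x, A x ^ 2 = ∑ i, MvPolynomial.eval x.ofLp (F i) ^ 2 := by
    intro x
    simp only [hA, map_sum, map_pow]
    rw [abs_of_nonneg (hsum x), ← Real.sqrt_eq_rpow, Real.sq_sqrt (hsum x)]
  have hAeq : ∀ x : EuclideanSpace ℝ (Fin d), Real.sqrt (∑ i : Fin d,
      (∑ j : Fin k → Fin d, M i j * hermiteTensor d k x j) ^ 2) = A x := by
    intro x
    rw [← Real.sqrt_sq (hA0 x), hAsq]
    simp [hF, hermiteSum, hermiteTensor_eq_eval]
  have hmap : ∫ ω, A (Z ω) ^ p ∂μ = ∫ x, |A x| ^ p ∂_root_.stdGaussian d := by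
    rw [← hZd, integral_map hZ.aemeasurable
      (hAc.abs.rpow_const fun _ => Or.inr hp0.le).aestronglyMeasurable]
    simp only [abs_of_nonneg (hA0 _)]
  simp only [hAeq, hmap]
  set N : Fin d → ℝ := fun i =>
    (∫ x, |MvPolynomial.eval x.ofLp (F i)| ^ p ∂_root_.stdGaussian d) ^ (2 / p) with hN
  have hbound : (∫ x, |A x| ^ p ∂_root_.stdGaussian d) ^ (2 / p) ≤ ∑ i, N i := by
    refine rpow_two_div_le_of_le_mul hp (integral_nonneg fun x => by positivity)
      (sum_nonneg fun i _ => Real.rpow_nonneg (integral_nonneg fun x => by positivity) _) ?_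
    calc ∫ x, |A x| ^ p ∂_root_.stdGaussian d
        = ∑ i, ∫ x, |A x| ^ (p - 2) * MvPolynomial.eval x.ofLp (F i) ^ 2
            ∂_root_.stdGaussian d := by
          rw [← integral_finsetSum]
          · refine integral_congr_ae (ae_of_all _ fun x => ?_)
            simp only
            rw [← mul_sum, ← hAsq, abs_rpow_sub_two_mul_sq hp]
          · intro i _
            simp only [sq]
            exact ((hAg.abs_rpow hp2).mul ((polyGrowth_eval _).mul (polyGrowth_eval _))).integrable
              ((hAc.abs.rpow_const fun _ => Or.inr hp2).mul
                ((continuous_eval _).mul (continuous_eval _)))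
      _ ≤ _ := by
          rw [mul_sum]
          exact sum_le_sum fun i _ => integral_abs_rpow_sub_two_mul_sq_le hp hAc
            (continuous_eval _) hAg (polyGrowth_eval _)
  refine hbound.trans ?_
  rw [mul_sum]
  exact sum_le_sum fun i _ => integral_abs_eval_hermiteSum_rpow_le hp k (M i)
end

section
/- Let W be a random vector in R^d with a density h with respect to the standard Gaussian measure γ, let Z ~ γ be independent of W, and for t > 0 set F_t = e^{−t} W + √(1−e^{−2t}) Z. If F_t has smooth positive density h_t with respect to γ and ρ_t = ∇ log h_t(F_t), then ρ_t = e^{−t} E[W − Z/√(e^{2t}−1) | F_t] almost surely. -/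
open MeasureTheory ProbabilityTheory

open scoped RealInnerProductSpace

section Stein

variable {d : ℕ}

/-- The density of the standard Gaussian measure with respect to Lebesgue measure. -/
noncomputable def stdGaussianPDF (d : ℕ) (x : EuclideanSpace ℝ (Fin d)) : ℝ :=
  (√(2 * Real.pi))⁻¹ ^ d * Real.exp (-‖x‖ ^ 2 / 2)

lemma stdGaussianPDF_nonneg (x : EuclideanSpace ℝ (Fin d)) : 0 ≤ stdGaussianPDF d x := by
  unfold stdGaussianPDF
  positivity

lemma stdGaussianPDF_eq_prod (x : EuclideanSpace ℝ (Fin d)) :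
    stdGaussianPDF d x = ∏ i, gaussianPDFReal 0 1 (x i) := by
  simp [stdGaussianPDF, gaussianPDFReal, Finset.prod_mul_distrib, ← Real.exp_sum,
    EuclideanSpace.real_norm_sq_eq, Finset.sum_div, neg_div]

lemma contDiff_stdGaussianPDF {n : WithTop ℕ∞} : ContDiff ℝ n (stdGaussianPDF d) := by
  unfold stdGaussianPDF
  exact contDiff_const.mul (((contDiff_norm_sq ℝ).neg.div_const 2).exp)

lemma fderiv_stdGaussianPDF (x v : EuclideanSpace ℝ (Fin d)) :
    fderiv ℝ (stdGaussianPDF d) x v = -(⟪v, x⟫ * stdGaussianPDF d x) := by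
  have h := (((hasStrictFDerivAt_norm_sq x).hasFDerivAt.neg.mul_const (2 : ℝ)⁻¹).exp).const_mul
    ((√(2 * Real.pi))⁻¹ ^ d)
  have h' : HasFDerivAt (stdGaussianPDF d) _ x := h
  rw [h'.fderiv]
  simp [stdGaussianPDF, real_inner_comm, div_eq_mul_inv]
  ring

lemma pi_gaussianReal_eq_withDensity :
    (Measure.pi fun _ : Fin d => gaussianReal 0 1) =
      volume.withDensity fun x => ENNReal.ofReal (∏ i, gaussianPDFReal 0 1 (x i)) := by
  refine (Measure.pi_eq fun s hs => ?_)
  have hint : Integrable (fun x : Fin d → ℝ => ∏ i, gaussianPDFReal 0 1 (x i)) volume :=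
    Integrable.fintype_prod fun _ => integrable_gaussianPDFReal 0 1
  rw [withDensity_apply _ (MeasurableSet.univ_pi hs),
    ← ofReal_integral_eq_lintegral_ofReal hint.restrict
      (ae_of_all _ fun x => Finset.prod_nonneg fun i _ => gaussianPDFReal_nonneg 0 1 _),
    volume_pi, Measure.restrict_pi_pi, integral_fintype_prod_eq_prod,
    ENNReal.ofReal_prod_of_nonneg fun i _ => integral_nonneg (gaussianPDFReal_nonneg 0 1)]
  simp_rw [gaussianReal_apply_eq_integral 0 one_ne_zero]

lemma stdGaussian_eq_withDensity :
    _root_.stdGaussian d = volume.withDensity fun x => ENNReal.ofReal (stdGaussianPDF d x) := by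
  have hm : Measurable fun x : EuclideanSpace ℝ (Fin d) => ENNReal.ofReal (stdGaussianPDF d x) :=
    (contDiff_stdGaussianPDF (n := 0)).continuous.measurable.ennreal_ofReal
  ext s hs
  rw [_root_.stdGaussian, Measure.map_apply (by fun_prop) hs, pi_gaussianReal_eq_withDensity,
    withDensity_apply _ hs, withDensity_apply _ (hs.preimage (by fun_prop)),
    ← (PiLp.volume_preserving_toLp (Fin d)).setLIntegral_comp_preimage hs hm]
  simp_rw [stdGaussianPDF_eq_prod]
  rfl

instance isGaussian_stdGaussian' : IsGaussian (_root_.stdGaussian d) := by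
  have h : _root_.stdGaussian d = ProbabilityTheory.stdGaussian (EuclideanSpace ℝ (Fin d)) :=
    map_pi_eq_stdGaussian
  rw [h]
  infer_instance

/-- Stein's identity for compactly supported test functions. -/
lemma integral_mul_inner_stdGaussian {ψ : EuclideanSpace ℝ (Fin d) → ℝ} (hψ : ContDiff ℝ 1 ψ)
    (hc : HasCompactSupport ψ) (v : EuclideanSpace ℝ (Fin d)) :
    ∫ x, ψ x * ⟪v, x⟫ ∂_root_.stdGaussian d = ∫ x, fderiv ℝ ψ x v ∂_root_.stdGaussian d := by
  have hp : Continuous (stdGaussianPDF d) := (contDiff_stdGaussianPDF (n := 0)).continuous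
  have hd : Continuous fun x => fderiv ℝ ψ x v :=
    (hψ.continuous_fderiv one_ne_zero).clm_apply continuous_const
  have hdc : HasCompactSupport fun x => fderiv ℝ ψ x v := hc.fderiv_apply ℝ v
  have key := integral_mul_fderiv_eq_neg_fderiv_mul_of_integrable (μ := volume) (f := ψ)
    (g := stdGaussianPDF d) (v := v)
    ((hd.mul hp).integrable_of_hasCompactSupport hdc.mul_right)
    (by
      simp_rw [fderiv_stdGaussianPDF]
      exact Continuous.integrable_of_hasCompactSupport
        (by have := hψ.continuous; fun_prop) hc.mul_right)
    ((hψ.continuous.mul hp).integrable_of_hasCompactSupport hc.mul_right)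
    (fun x _ => (hψ.differentiable one_ne_zero) x)
    (fun x _ => (contDiff_stdGaussianPDF.differentiable one_ne_zero) x)
  simp_rw [fderiv_stdGaussianPDF, mul_neg, integral_neg, neg_inj] at key
  rw [stdGaussian_eq_withDensity, integral_withDensity_eq_integral_toReal_smul
      hp.measurable.ennreal_ofReal (by simp),
    integral_withDensity_eq_integral_toReal_smul hp.measurable.ennreal_ofReal (by simp)]
  simp_rw [ENNReal.toReal_ofReal (stdGaussianPDF_nonneg _), smul_eq_mul,
    mul_comm (stdGaussianPDF d _), mul_assoc]
  exact key

end Stein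

section Score

variable {d : ℕ}

/-- Integration by parts for the score of a positive density relative to the standard Gaussian. -/
lemma integral_mul_inner_gradient_log {k φ : EuclideanSpace ℝ (Fin d) → ℝ} (hk : ContDiff ℝ 1 k)
    (hpos : ∀ x, 0 < k x) (hφ : ContDiff ℝ 1 φ) (hc : HasCompactSupport φ)
    {ν : Measure (EuclideanSpace ℝ (Fin d))}
    (hν : ν = (_root_.stdGaussian d).withDensity fun x => ENNReal.ofReal (k x))
    (v : EuclideanSpace ℝ (Fin d)) :
    ∫ x, φ x * ⟪v, gradient (fun y => Real.log (k y)) x⟫ ∂ν =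
      ∫ x, φ x * ⟪v, x⟫ ∂ν - ∫ x, fderiv ℝ φ x v ∂ν := by
  have hkm : Measurable fun x => ENNReal.ofReal (k x) := hk.continuous.measurable.ennreal_ofReal
  have hφd : Continuous fun x => fderiv ℝ φ x v :=
    (hφ.continuous_fderiv one_ne_zero).clm_apply continuous_const
  have hkd := hk.continuous
  have hφc := hφ.continuous
  have hstein := integral_mul_inner_stdGaussian (hφ.mul hk) (hc.mul_right (f' := k)) v
  subst hν
  simp_rw [integral_withDensity_eq_integral_toReal_smul hkm
    (ae_of_all _ fun _ => ENNReal.ofReal_lt_top), ENNReal.toReal_ofReal (hpos _).le, smul_eq_mul]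
  have hfd : ∀ x, fderiv ℝ (fun x => φ x * k x) x v = φ x * fderiv ℝ k x v + k x * fderiv ℝ φ x v := by
    intro x
    rw [fderiv_fun_mul (hφ.differentiable one_ne_zero x) (hk.differentiable one_ne_zero x)]
    simp
  have hgrad : ∀ x, k x * (φ x * ⟪v, gradient (fun y => Real.log (k y)) x⟫) =
      φ x * fderiv ℝ k x v := by
    intro x
    rw [inner_gradient_right,
      fderiv.log (hk.differentiable one_ne_zero x) (hpos x).ne']
    have := (hpos x).ne'
    simp
    field_simp
  have hkd' : Continuous fun x => fderiv ℝ k x v :=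
    (hk.continuous_fderiv one_ne_zero).clm_apply continuous_const
  simp_rw [hfd] at hstein
  have hint₁ : Integrable (fun x => φ x * fderiv ℝ k x v) (_root_.stdGaussian d) :=
    Continuous.integrable_of_hasCompactSupport (by fun_prop) hc.mul_right
  have hint₂ : Integrable (fun x => k x * fderiv ℝ φ x v) (_root_.stdGaussian d) :=
    Continuous.integrable_of_hasCompactSupport (by fun_prop) (hc.fderiv_apply ℝ v).mul_left
  rw [integral_add hint₁ hint₂, ← sub_eq_iff_eq_add] at hstein
  simp_rw [hgrad]
  rw [← hstein]
  congr 2 with x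
  ring

variable {Ω : Type*} [MeasurableSpace Ω] {μ : Measure Ω} [IsProbabilityMeasure μ]
  {X Z : Ω → EuclideanSpace ℝ (Fin d)}

/-- Stein's identity for a Gaussian perturbation of an independent random vector. -/
lemma integral_comp_add_smul_mul_inner (hX : Measurable X) (hZ : Measurable Z)
    (hZd : Measure.map Z μ = _root_.stdGaussian d) (hindep : IndepFun X Z μ) {b : ℝ} (hb : b ≠ 0)
    {φ : EuclideanSpace ℝ (Fin d) → ℝ} (hφ : ContDiff ℝ 1 φ) (hc : HasCompactSupport φ)
    (v : EuclideanSpace ℝ (Fin d)) :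
    ∫ ω, φ (X ω + b • Z ω) * ⟪v, Z ω⟫ ∂μ = b * ∫ ω, fderiv ℝ φ (X ω + b • Z ω) v ∂μ := by
  have hφc := hφ.continuous
  have hφd : Continuous fun x => fderiv ℝ φ x v :=
    (hφ.continuous_fderiv one_ne_zero).clm_apply continuous_const
  have hprod := (indepFun_iff_map_prod_eq_prod_map_map hX.aemeasurable hZ.aemeasurable).1 hindep
  rw [hZd] at hprod
  have : IsProbabilityMeasure (Measure.map X μ) := Measure.isProbabilityMeasure_map hX.aemeasurable
  have hmeas : AEMeasurable (fun ω => (X ω, Z ω)) μ := (hX.prodMk hZ).aemeasurable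
  obtain ⟨C₁, hC₁⟩ := hφc.bounded_above_of_compact_support hc
  obtain ⟨C₂, hC₂⟩ := hφd.bounded_above_of_compact_support (hc.fderiv_apply ℝ v)
  have hcont₁ : Continuous fun p : EuclideanSpace ℝ (Fin d) × EuclideanSpace ℝ (Fin d) =>
      φ (p.1 + b • p.2) := by fun_prop
  have hcont₂ : Continuous fun p : EuclideanSpace ℝ (Fin d) × EuclideanSpace ℝ (Fin d) =>
      fderiv ℝ φ (p.1 + b • p.2) v :=
    hφd.comp (continuous_fst.add (continuous_snd.const_smul b))
  have hinner : Integrable (fun p : EuclideanSpace ℝ (Fin d) × EuclideanSpace ℝ (Fin d) =>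
      ⟪v, p.2⟫) ((Measure.map X μ).prod (_root_.stdGaussian d)) :=
    (IsGaussian.integrable_id.const_inner v).comp_snd _
  have hint₁ : Integrable (fun p : EuclideanSpace ℝ (Fin d) × EuclideanSpace ℝ (Fin d) =>
      φ (p.1 + b • p.2) * ⟪v, p.2⟫) ((Measure.map X μ).prod (_root_.stdGaussian d)) :=
    hinner.bdd_mul hcont₁.aestronglyMeasurable (ae_of_all _ fun _ => hC₁ _)
  have hint₂ : Integrable (fun p : EuclideanSpace ℝ (Fin d) × EuclideanSpace ℝ (Fin d) =>
      fderiv ℝ φ (p.1 + b • p.2) v) ((Measure.map X μ).prod (_root_.stdGaussian d)) :=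
    Integrable.of_bound hcont₂.aestronglyMeasurable C₂ (ae_of_all _ fun _ => hC₂ _)
  rw [← integral_map (f := fun p : EuclideanSpace ℝ (Fin d) × EuclideanSpace ℝ (Fin d) =>
      φ (p.1 + b • p.2) * ⟪v, p.2⟫) hmeas (hprod ▸ hint₁.aestronglyMeasurable),
    ← integral_map (f := fun p : EuclideanSpace ℝ (Fin d) × EuclideanSpace ℝ (Fin d) =>
      fderiv ℝ φ (p.1 + b • p.2) v) hmeas hcont₂.aestronglyMeasurable,
    hprod, integral_prod _ hint₁, integral_prod _ hint₂, ← integral_const_mul]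
  congr 1 with x
  have hcx : HasCompactSupport fun z => φ (x + b • z) :=
    hc.comp_homeomorph ((Homeomorph.smulOfNeZero b hb).trans (Homeomorph.addLeft x))
  have hfd : ∀ z, fderiv ℝ (fun z => φ (x + b • z)) z v = b * fderiv ℝ φ (x + b • z) v := by
    intro z
    have hg : HasFDerivAt (fun z => x + b • z)
        (b • ContinuousLinearMap.id ℝ (EuclideanSpace ℝ (Fin d))) z :=
      ((hasFDerivAt_id z).const_smul b).const_add x
    have := ((hφ.differentiable one_ne_zero (x + b • z)).hasFDerivAt.comp z hg).fderiv
    simp only [Function.comp_def] at this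
    rw [this]
    simp
  rw [← integral_const_mul]
  simp_rw [← hfd]
  exact integral_mul_inner_stdGaussian (by fun_prop) hcx v

/-- Tweedie's formula: if the law of `X + bZ` has positive `C¹` density `k` relative to the standard
Gaussian, the conditional expectation of `X + bZ - Z / b` given `X + bZ` is the score. -/
lemma condExp_eq_gradient_log_comp (hX : Measurable X) (hXi : Integrable X μ) (hZ : Measurable Z)
    (hZd : Measure.map Z μ = _root_.stdGaussian d) (hindep : IndepFun X Z μ) {b : ℝ} (hb : b ≠ 0)
    {k : EuclideanSpace ℝ (Fin d) → ℝ} (hk : ContDiff ℝ 1 k) (hpos : ∀ x, 0 < k x)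
    {F : Ω → EuclideanSpace ℝ (Fin d)} (hF : F = fun ω => X ω + b • Z ω)
    (hFd : Measure.map F μ =
      (_root_.stdGaussian d).withDensity fun x => ENNReal.ofReal (k x)) :
    μ[fun ω => F ω - b⁻¹ • Z ω | MeasurableSpace.comap F (borel (EuclideanSpace ℝ (Fin d)))]
      =ᵐ[μ] fun ω => gradient (fun x => Real.log (k x)) (F ω) := by
  rw [← BorelSpace.measurable_eq]
  have hFm : Measurable F := by rw [hF]; fun_prop
  have hZi : Integrable Z μ := by
    have h : Integrable id (Measure.map Z μ) := by rw [hZd]; exact IsGaussian.integrable_id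
    exact h.comp_measurable hZ
  have hFi : Integrable F μ := by rw [hF]; exact hXi.add (hZi.smul b)
  have hYi : Integrable (fun ω => F ω - b⁻¹ • Z ω) μ := hFi.sub (hZi.smul b⁻¹)
  set Y := fun ω => F ω - b⁻¹ • Z ω with hY
  have hm : MeasurableSpace.comap F inferInstance ≤ ‹MeasurableSpace Ω› := hFm.comap_le
  obtain ⟨g, hg, hgF⟩ := (stronglyMeasurable_condExp (f := Y) (μ := μ)
    (m := MeasurableSpace.comap F inferInstance)).exists_eq_measurable_comp
  have hgi : Integrable g (Measure.map F μ) := by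
    rw [integrable_map_measure hg.aestronglyMeasurable hFm.aemeasurable, ← hgF]
    exact integrable_condExp
  have hscore : Continuous (gradient fun x => Real.log (k x)) := by
    have h : ContDiff ℝ 1 fun x => Real.log (k x) := hk.log fun x => (hpos x).ne'
    exact (InnerProductSpace.toDual ℝ _).symm.continuous.comp (h.continuous_fderiv one_ne_zero)
  have : IsProbabilityMeasure (Measure.map F μ) := Measure.isProbabilityMeasure_map hFm.aemeasurable
  have hae : ∀ᵐ x ∂Measure.map F μ, g x = gradient (fun x => Real.log (k x)) x := by
    refine ae_eq_of_integral_contDiff_smul_eq hgi.locallyIntegrable hscore.locallyIntegrable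
      fun φ hφ hc => ?_
    have hφ1 : ContDiff ℝ 1 φ := hφ.of_le (by exact_mod_cast le_top)
    have hφc := hφ.continuous
    have hφd (v : EuclideanSpace ℝ (Fin d)) : Continuous fun x => fderiv ℝ φ x v :=
      (hφ1.continuous_fderiv one_ne_zero).clm_apply continuous_const
    obtain ⟨C, hC⟩ := hφc.bounded_above_of_compact_support hc
    have hφm : StronglyMeasurable[MeasurableSpace.comap F inferInstance] (φ ∘ F) :=
      (hφc.measurable.comp (comap_measurable F)).stronglyMeasurable
    have hbdd {E : Type} [NormedAddCommGroup E] [NormedSpace ℝ E] {f : Ω → E}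
        (hf : Integrable f μ) : Integrable (fun ω => φ (F ω) • f ω) μ :=
      hf.bdd_smul C (hφm.mono hm).aestronglyMeasurable (ae_of_all _ fun _ => hC _)
    have hcond : ∫ x, φ x • g x ∂Measure.map F μ = ∫ ω, φ (F ω) • Y ω ∂μ := by
      rw [integral_map hFm.aemeasurable (by fun_prop),
        ← integral_condExp hm (f := fun ω => φ (F ω) • Y ω)]
      refine integral_congr_ae ?_
      have := condExp_smul_of_aestronglyMeasurable_left (μ := μ) (g := Y)
        hφm.aestronglyMeasurable (hbdd hYi) hYi
      filter_upwards [this] with ω hω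
      refine Eq.trans ?_ hω.symm
      simp [hgF]
    rw [hcond]
    refine ext_inner_left ℝ fun v => ?_
    have hint : Integrable (fun x => φ x • gradient (fun x => Real.log (k x)) x)
        (Measure.map F μ) :=
      Continuous.integrable_of_hasCompactSupport (by fun_prop) hc.smul_right
    rw [← integral_inner (hbdd hYi), ← integral_inner hint]
    simp_rw [real_inner_smul_right]
    rw [integral_mul_inner_gradient_log hk hpos hφ1 hc hFd v,
      integral_map hFm.aemeasurable (by fun_prop),
      integral_map hFm.aemeasurable (hφd v).aestronglyMeasurable]
    have hs := integral_comp_add_smul_mul_inner hX hZ hZd hindep hb hφ1 hc v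
    have hs' : ∫ ω, φ (F ω) * ⟪v, Z ω⟫ ∂μ = b * ∫ ω, fderiv ℝ φ (F ω) v ∂μ := by
      simpa [hF] using hs
    simp_rw [hY, inner_sub_right, real_inner_smul_right, mul_sub, mul_left_comm _ b⁻¹]
    have hint₁ : Integrable (fun ω => φ (F ω) * ⟪v, F ω⟫) μ := hbdd (hFi.const_inner v)
    have hint₂ : Integrable (fun ω => φ (F ω) * ⟪v, Z ω⟫) μ := hbdd (hZi.const_inner v)
    rw [integral_sub hint₁ (hint₂.const_mul _),
      integral_const_mul, hs', inv_mul_cancel_left₀ hb]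
  rw [hgF]
  exact ae_of_ae_map hFm.aemeasurable hae

end Score

lemma integrable_of_map_eq_withDensity_of_le {E : Type*} [NormedAddCommGroup E]
    [MeasurableSpace E] [BorelSpace E] [SecondCountableTopology E] {Ω : Type*} [MeasurableSpace Ω]
    {μ : Measure Ω} {γ : Measure E} {W : Ω → E} {h : E → ℝ} {C : ℝ} (hW : Measurable W)
    (hWd : Measure.map W μ = γ.withDensity fun x => ENNReal.ofReal (h x)) (hbd : ∀ x, h x ≤ C)
    (hγ : Integrable id γ) : Integrable W μ := by
  have hle : Measure.map W μ ≤ ENNReal.ofReal C • γ := by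
    rw [hWd, ← withDensity_const]
    exact withDensity_mono (ae_of_all _ fun x => ENNReal.ofReal_le_ofReal (hbd x))
  exact ((hγ.smul_measure ENNReal.ofReal_ne_top).mono_measure hle).comp_measurable hW

/-- Score function representation: if `W` has bounded density `h` (with bounded gradient)
with respect to the standard Gaussian `γ`, `Z ~ γ` independent of `W`,
`F_t = e^{−t}W + √(1−e^{−2t})Z` has smooth positive density `ht` with respect to `γ`, then
the score `ρ_t = ∇ log ht (F_t)` satisfies
`ρ_t = e^{−t} E[W − Z/√(e^{2t}−1) | F_t]` a.s. -/
theorem score_representation {Ω : Type*} [MeasurableSpace Ω] (μ : Measure Ω)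
    [IsProbabilityMeasure μ] (d : ℕ) (W Z : Ω → EuclideanSpace ℝ (Fin d))
    (hW : Measurable W) (hZ : Measurable Z)
    (hZd : Measure.map Z μ = stdGaussian d) (hindep : IndepFun W Z μ)
    (h : EuclideanSpace ℝ (Fin d) → ℝ)
    (hWd : Measure.map W μ = (stdGaussian d).withDensity (fun x => ENNReal.ofReal (h x)))
    (hdiff : ContDiff ℝ 1 h) (C : ℝ) (hbd : ∀ x, |h x| ≤ C) (hgradbd : ∀ x, ‖gradient h x‖ ≤ C)
    (t : ℝ) (ht : 0 < t)
    (F : Ω → EuclideanSpace ℝ (Fin d))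
    (hF : F = fun ω => Real.exp (-t) • W ω + Real.sqrt (1 - Real.exp (-2 * t)) • Z ω)
    (hdens : EuclideanSpace ℝ (Fin d) → ℝ) (hsmooth : ContDiff ℝ (⊤ : ℕ∞) hdens)
    (hpos : ∀ x, 0 < hdens x)
    (hFd : Measure.map F μ = (stdGaussian d).withDensity (fun x => ENNReal.ofReal (hdens x))) :
    (fun ω => gradient (fun x => Real.log (hdens x)) (F ω)) =ᵐ[μ]
      μ[(fun ω => Real.exp (-t) •
          (W ω - (Real.sqrt (Real.exp (2 * t) - 1))⁻¹ • Z ω)) |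
        MeasurableSpace.comap F (borel (EuclideanSpace ℝ (Fin d)))] := by
  have ha2 : Real.exp (-t) ^ 2 = Real.exp (-2 * t) := by
    rw [← Real.exp_nat_mul]
    congr 1
    push_cast
    ring
  have hb2 : 0 < 1 - Real.exp (-2 * t) := by
    have : Real.exp (-2 * t) < 1 := Real.exp_lt_one_iff.2 (by linarith)
    linarith
  have hexp : Real.exp (2 * t) - 1 = (1 - Real.exp (-2 * t)) / Real.exp (-t) ^ 2 := by
    rw [ha2, sub_div, div_self (Real.exp_pos _).ne', one_div, ← Real.exp_neg]
    congr 2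
    ring
  rw [hexp, Real.sqrt_div hb2.le, Real.sqrt_sq (Real.exp_pos _).le, inv_div]
  set a := Real.exp (-t)
  set b := √(1 - Real.exp (-2 * t)) with hb
  have hb0 : b ≠ 0 := (Real.sqrt_pos.2 hb2).ne'
  have hab : a * (a / b) = b⁻¹ - b := by
    have : b ^ 2 = 1 - a ^ 2 := by rw [hb, Real.sq_sqrt hb2.le, ha2]
    field_simp
    linarith
  have hWi : Integrable W μ := integrable_of_map_eq_withDensity_of_le hW hWd
    (fun x => (le_abs_self _).trans (hbd x)) IsGaussian.integrable_id
  have hY : (fun ω => a • (W ω - (a / b) • Z ω)) = fun ω => F ω - b⁻¹ • Z ω := by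
    ext1 ω
    rw [hF, smul_sub, smul_smul, hab]
    module
  rw [hY]
  exact (condExp_eq_gradient_log_comp (X := fun ω => a • W ω) (hW.const_smul a) (hWi.smul a) hZ hZd
    (hindep.comp (measurable_const_smul a) measurable_id) hb0
    (hsmooth.of_le (by exact_mod_cast le_top)) hpos hF hFd).symm
end
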